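/- Let J be a sparse symmetric shifted ideal in Z, let Λ(J) = {λ^{(1)} ≺ ⋯ ≺ λ^{(t)}} be the set of partitions of its minimal monomial generators, and for each k let J_{≤k} be the ideal generated by all σ(z^{λ^{(i)}}) with σ ∈ S_s and i ≤ k. Fix k and write λ^{(k)} = (λ_1,…,λ_s). Then the intersection ⟨σ(z^{λ^{(k)}}) : σ ∈ S_s⟩ ∩ J_{≤k−1} equals the sum of the two ideals K_1 = ⟨σ(z^{λ^{(k)}} z_{i,j}) : σ ∈ S_s, λ_i > 0 and 1 ≤ j < λ_i⟩ and K_2 = ⟨σ(z^{λ^{(k)}} z_{i,j}) : σ ∈ S_s, λ_i = 0 and 1 ≤ j < λ_s⟩. -/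

import Mathlib

open MvPolynomial

/-- The sparse squarefree monomial `z^μ = ∏_{i : μ i > 0} z_{i, μ i}`, where the variable
`z_{i,j}` (for `1 ≤ j ≤ b`) is represented by `X (i, j-1)`. -/
noncomputable def sparseMon (K : Type*) [Field K] (s b : ℕ) (μ : Fin s → ℕ) :
    MvPolynomial (Fin s × Fin b) K :=
  ∏ i : Fin s, ∏ j : Fin b, if μ i = (j : ℕ) + 1 then X (i, j) else 1

/-- `μ' ≤₀ μ`. -/
def leZero {s : ℕ} (μ' μ : Fin s → ℕ) : Prop :=
  ∀ i, μ' i ≤ μ i ∧ (μ' i = 0 ↔ μ i = 0)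

/-- The action of `σ ∈ S_s` on `Z`, sending `z_{i,j}` to `z_{σ i, j}`. -/
noncomputable def permMap (K : Type*) [Field K] (s b : ℕ) (σ : Equiv.Perm (Fin s)) :
    MvPolynomial (Fin s × Fin b) K →ₐ[K] MvPolynomial (Fin s × Fin b) K :=
  rename fun p => (σ p.1, p.2)

/-- `z^μ` is a minimal monomial generator of the monomial ideal `J`. -/
def IsMinSparseGen (K : Type*) [Field K] (s b : ℕ)
    (J : Ideal (MvPolynomial (Fin s × Fin b) K)) (μ : Fin s → ℕ) : Prop :=
  (∀ i, μ i ≤ b) ∧ sparseMon K s b μ ∈ J ∧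
    ∀ i, 0 < μ i → sparseMon K s b (Function.update μ i 0) ∉ J

/-- A proper monomial ideal `J` of `Z` is sparse symmetric shifted if (S-1) it is generated
by sparse squarefree monomials, (S-2) for every minimal monomial generator `z^μ` and every
`μ' ≤₀ μ` one has `z^{μ'} ∈ J`, and (S-3) `σ(J) = J` for every permutation `σ`. -/
def IsSSS (K : Type*) [Field K] (s b : ℕ)
    (J : Ideal (MvPolynomial (Fin s × Fin b) K)) : Prop :=
  J ≠ ⊤ ∧
  (∃ S : Set (Fin s → ℕ), (∀ μ ∈ S, ∀ i, μ i ≤ b) ∧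
      J = Ideal.span (sparseMon K s b '' S)) ∧
  (∀ μ : Fin s → ℕ, IsMinSparseGen K s b J μ →
      ∀ μ' : Fin s → ℕ, leZero μ' μ → sparseMon K s b μ' ∈ J) ∧
  (∀ σ : Equiv.Perm (Fin s), Ideal.map (permMap K s b σ) J = J)

/-- The support degree: number of nonzero entries. -/
def suppdeg {s : ℕ} (ν : Fin s → ℕ) : ℕ := (Finset.univ.filter fun i => ν i ≠ 0).card

/-- The weight: sum of the entries. -/
def wt {s : ℕ} (ν : Fin s → ℕ) : ℕ := ∑ i, ν i

/-- The associated partition: the nondecreasing rearrangement of the tuple. -/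
noncomputable def partOf {s : ℕ} (ν : Fin s → ℕ) : Fin s → ℕ := ν ∘ Tuple.sort ν

/-- Exponent vector of the sparse squarefree monomial `z^ν`. -/
def exps {s b : ℕ} (ν : Fin s → ℕ) : Fin s × Fin b → ℕ :=
  fun p => if ν p.1 = (p.2 : ℕ) + 1 then 1 else 0

/-- `z^ν >_lex z^{ν'}` for the lexicographic order on monomials induced by the variable
order `z_{i,j} > z_{i',j'}` iff `j < j'`, or `j = j'` and `i < i'`. -/
def monLexGT {s : ℕ} (b : ℕ) (ν ν' : Fin s → ℕ) : Prop :=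
  ∃ v : Fin s × Fin b, exps ν' v < exps ν v ∧
    ∀ w : Fin s × Fin b,
      ((w.2 : ℕ) < (v.2 : ℕ) ∨ ((w.2 : ℕ) = (v.2 : ℕ) ∧ (w.1 : ℕ) < (v.1 : ℕ))) →
        exps (b := b) ν w = exps ν' w

/-- The order `≺` on tuples: first compare support degrees, then weights, then the
leftmost nonzero entry of the difference must be negative. -/
def partLT {s : ℕ} (l l' : Fin s → ℕ) : Prop :=
  suppdeg l < suppdeg l' ∨
  (suppdeg l = suppdeg l' ∧ wt l < wt l') ∨
  (suppdeg l = suppdeg l' ∧ wt l = wt l' ∧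
    ∃ i : Fin s, l i < l' i ∧ ∀ j : Fin s, j < i → l j = l' j)

/-- The order `≺` on (tuples representing) minimal monomial generators:
`f₁ ≺ f₂` iff `λ(f₁) ≺ λ(f₂)`, or `λ(f₁) = λ(f₂)` and `f₁ >_lex f₂`. -/
def genPrec {s : ℕ} (b : ℕ) (ν ν' : Fin s → ℕ) : Prop :=
  partLT (partOf ν) (partOf ν') ∨ (partOf ν = partOf ν' ∧ monLexGT b ν ν')

/-- `J_f = ⟨g ∈ G(J) : g ≺ f⟩`, where `f = z^ν`. -/
noncomputable def Jf (K : Type*) [Field K] (s b : ℕ)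
    (J : Ideal (MvPolynomial (Fin s × Fin b) K)) (ν : Fin s → ℕ) :
    Ideal (MvPolynomial (Fin s × Fin b) K) :=
  Ideal.span {g | ∃ ν' : Fin s → ℕ,
    IsMinSparseGen K s b J ν' ∧ genPrec b ν' ν ∧ g = sparseMon K s b ν'}

/-- Exponent vector of `z^μ` as a finitely supported function. -/
noncomputable def sparseExp {s : ℕ} (b : ℕ) (μ : Fin s → ℕ) : Fin s × Fin b →₀ ℕ :=
  Finsupp.equivFunOnFinite.symm (exps μ)

lemma sparseMon_eq_monomial (K : Type*) [Field K] (s b : ℕ) (μ : Fin s → ℕ) :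
    sparseMon K s b μ = monomial (sparseExp b μ) 1 := by
  rw [MvPolynomial.monomial_eq, Finsupp.prod_fintype _ _ (by simp), Fintype.prod_prod_type]
  simp only [sparseMon, map_one, one_mul]
  refine Finset.prod_congr rfl fun i _ => Finset.prod_congr rfl fun j _ => ?_
  simp only [sparseExp, exps, Finsupp.equivFunOnFinite_symm_apply_apply]
  split_ifs <;> simp

lemma permMap_sparseMon (K : Type*) [Field K] (s b : ℕ) (σ : Equiv.Perm (Fin s))
    (μ : Fin s → ℕ) : permMap K s b σ (sparseMon K s b μ) = sparseMon K s b (μ ∘ σ.symm) := by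
  simp only [sparseMon, permMap, map_prod]
  refine Fintype.prod_equiv σ _ _ fun i => Finset.prod_congr rfl fun j _ => ?_
  simp only [Function.comp_apply, Equiv.symm_apply_apply]
  split_ifs <;> simp

lemma sparseMon_dvd_of_forall (K : Type*) [Field K] {s b : ℕ} {ν μ : Fin s → ℕ}
    (h : ∀ i, ν i ≠ 0 → μ i = ν i) : sparseMon K s b ν ∣ sparseMon K s b μ := by
  refine Finset.prod_dvd_prod_of_dvd _ _ fun i _ => Finset.prod_dvd_prod_of_dvd _ _ fun j _ => ?_
  by_cases hν : ν i = (j : ℕ) + 1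
  · rw [h i (by omega)]
  · simp [hν]

lemma exists_exponent_le_of_mem_span {K σ : Type*} [Field K] {S : Set (MvPolynomial σ K)}
    (hS : ∀ g ∈ S, ∃ e, g = monomial e 1) {x : MvPolynomial σ K} (hx : x ∈ Ideal.span S)
    {m : σ →₀ ℕ} (hm : m ∈ x.support) : ∃ e ≤ m, monomial e 1 ∈ S := by
  have hS' : S = (fun e => monomial e (1 : K)) '' {e | monomial e 1 ∈ S} := by
    ext g
    constructor
    · intro hg
      obtain ⟨e, rfl⟩ := hS g hg
      exact ⟨e, hg, rfl⟩
    · rintro ⟨e, he, rfl⟩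
      exact he
  rw [hS', mem_ideal_span_monomial_image] at hx
  obtain ⟨e, he, hle⟩ := hx m hm
  exact ⟨e, hle, he⟩

lemma monomial_mem_of_le {K σ : Type*} [Field K] {I : Ideal (MvPolynomial σ K)}
    {e m : σ →₀ ℕ} (he : monomial e 1 ∈ I) (hle : e ≤ m) (c : K) : monomial m c ∈ I := by
  have h : monomial m c = monomial (m - e) c * monomial e 1 := by
    rw [monomial_mul, mul_one, tsub_add_cancel_of_le hle]
  rw [h]
  exact I.mul_mem_left _ he

lemma wt_comp_perm {s : ℕ} (ν : Fin s → ℕ) (σ : Equiv.Perm (Fin s)) : wt (ν ∘ σ) = wt ν :=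
  Equiv.sum_comp σ ν

lemma suppdeg_comp_perm {s : ℕ} (ν : Fin s → ℕ) (σ : Equiv.Perm (Fin s)) :
    suppdeg (ν ∘ σ) = suppdeg ν := by
  simp only [suppdeg, Finset.card_filter]
  exact Equiv.sum_comp σ fun i => if ν i ≠ 0 then 1 else 0

lemma suppdeg_lt_of_forall {s : ℕ} {ν μ : Fin s → ℕ} (h : ∀ i, ν i ≠ 0 → μ i ≠ 0)
    {i : Fin s} (hν : ν i = 0) (hμ : μ i ≠ 0) : suppdeg ν < suppdeg μ := by
  refine Finset.card_lt_card ((Finset.ssubset_iff_of_subset fun j => ?_).2 ⟨i, ?_, ?_⟩)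
  · simpa using h j
  · simpa using hμ
  · simpa using hν

lemma eq_of_monotone_of_comp_perm {s : ℕ} {f g : Fin s → ℕ} (hf : Monotone f) (hg : Monotone g)
    (σ : Equiv.Perm (Fin s)) (h : f ∘ σ = g) : f = g := by
  have h₁ := Tuple.comp_sort_eq_comp_iff_monotone (f := f) (σ := σ)
  have h₂ := Tuple.comp_sort_eq_comp_iff_monotone (f := f) (σ := Equiv.refl _)
  have h₃ := h₁.2 (h ▸ hg)
  have h₄ := h₂.2 (by simpa using hf)
  rw [← h, h₃, ← h₄]
  rfl

lemma IsSSS.sparseMon_comp_mem {K : Type*} [Field K] {s b : ℕ}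
    {J : Ideal (MvPolynomial (Fin s × Fin b) K)} (hJ : IsSSS K s b J) {μ : Fin s → ℕ}
    (hμ : sparseMon K s b μ ∈ J) (σ : Equiv.Perm (Fin s)) : sparseMon K s b (μ ∘ σ) ∈ J := by
  have h := Ideal.mem_map_of_mem (permMap K s b σ.symm) hμ
  rwa [hJ.2.2.2, permMap_sparseMon, Equiv.symm_symm] at h

lemma IsMinSparseGen.comp_perm {K : Type*} [Field K] {s b : ℕ}
    {J : Ideal (MvPolynomial (Fin s × Fin b) K)} (hJ : IsSSS K s b J) {μ : Fin s → ℕ}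
    (hμ : IsMinSparseGen K s b J μ) (σ : Equiv.Perm (Fin s)) :
    IsMinSparseGen K s b J (μ ∘ σ) := by
  refine ⟨fun i => hμ.1 _, hJ.sparseMon_comp_mem hμ.2.1 σ, fun i hi hmem => ?_⟩
  refine hμ.2.2 (σ i) hi ?_
  have h := hJ.sparseMon_comp_mem hmem σ.symm
  convert h using 2
  ext j
  by_cases hj : j = σ i
  · subst hj; simp
  · have : σ.symm j ≠ i := fun h => hj (by rw [← h]; simp)
    simp [Function.update_of_ne, hj, this]

lemma exists_isMinSparseGen_of_mem {K : Type*} [Field K] {s b : ℕ}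
    {J : Ideal (MvPolynomial (Fin s × Fin b) K)} {μ : Fin s → ℕ} (hb : ∀ i, μ i ≤ b)
    (hμ : sparseMon K s b μ ∈ J) :
    ∃ ρ, IsMinSparseGen K s b J ρ ∧ ∀ i, ρ i ≠ 0 → μ i = ρ i := by
  induction hn : suppdeg μ using Nat.strong_induction_on generalizing μ with
  | _ n ih =>
    by_cases hmin : ∀ i, 0 < μ i → sparseMon K s b (Function.update μ i 0) ∉ J
    · exact ⟨μ, ⟨hb, hμ, hmin⟩, fun _ _ => rfl⟩
    · push Not at hmin
      obtain ⟨i, hi, hmem⟩ := hmin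
      have hupd : ∀ j, Function.update μ i 0 j ≠ 0 → μ j = Function.update μ i 0 j := by
        intro j hj
        by_cases hji : j = i
        · subst hji; simp at hj
        · simp [hji]
      have hlt : suppdeg (Function.update μ i 0) < suppdeg μ :=
        suppdeg_lt_of_forall (fun j hj => by rw [hupd j hj]; exact hj) (i := i) (by simp) hi.ne'
      obtain ⟨ρ, hρ, hle⟩ := ih _ (hn ▸ hlt) (fun j => by
        by_cases hji : j = i
        · subst hji; simp
        · simpa [hji] using hb j) hmem rfl
      refine ⟨ρ, hρ, fun j hj => ?_⟩
      rw [← hle j hj]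
      exact hupd j (by rw [hle j hj]; exact hj)

/-- If every nonzero entry of `β` dominates the corresponding entry of `α`, or all entries of `α`
where `α` vanishes, then `β` can be permuted so that its support lies in that of `α`, on which
it dominates `α`. -/
lemma exists_perm_dominating {s : ℕ} {α β : Fin s → ℕ} (hcard : suppdeg β ≤ suppdeg α)
    (h₁ : ∀ p, β p ≠ 0 → α p ≠ 0 → α p ≤ β p)
    (h₂ : ∀ p q, β p ≠ 0 → α p = 0 → α q ≤ β p) :
    ∃ π : Equiv.Perm (Fin s), ∀ p, β (π p) ≠ 0 → α p ≠ 0 ∧ α p ≤ β (π p) := by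
  classical
  set A := Finset.univ.filter fun i => α i ≠ 0 with hA
  set B := Finset.univ.filter fun i => β i ≠ 0 with hB
  have hc : (B \ A).card ≤ (A \ B).card := Finset.card_sdiff_le_card_sdiff_iff.2 hcard
  obtain ⟨f⟩ := Function.Embedding.nonempty_of_card_le (α := ↥(B \ A)) (β := ↥(A \ B))
    (by simpa only [Fintype.card_coe] using hc)
  have hfA : ∀ x, (f x : Fin s) ∈ A := fun x => (Finset.mem_sdiff.1 (f x).2).1
  have hfB : ∀ x, (f x : Fin s) ∉ B := fun x => (Finset.mem_sdiff.1 (f x).2).2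
  let g : ↥B → Fin s := fun x =>
    if h : (x : Fin s) ∈ A then x else f ⟨x, Finset.mem_sdiff.2 ⟨x.2, h⟩⟩
  have hg : Function.Injective g := by
    intro x y hxy
    by_cases hx : (x : Fin s) ∈ A <;> by_cases hy : (y : Fin s) ∈ A <;>
      simp only [g, hx, hy, dite_true, dite_false] at hxy
    · exact Subtype.ext hxy
    · exact absurd (hxy ▸ x.2) (hfB _)
    · exact absurd (hxy ▸ y.2) (hfB _)
    · have := f.injective (Subtype.ext hxy)
      exact Subtype.ext (Subtype.mk.inj this)
  obtain ⟨σ, hσ⟩ := Equiv.Perm.exists_extending_pair (fun x : ↥B => (x : Fin s)) g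
    Subtype.val_injective hg
  refine ⟨σ.symm, fun p hp => ?_⟩
  have hpB : σ.symm p ∈ B := by simpa [hB] using hp
  have hgp : p = g ⟨σ.symm p, hpB⟩ := by simpa using hσ ⟨σ.symm p, hpB⟩
  by_cases h : σ.symm p ∈ A
  · have hp' : p = σ.symm p := by simpa [g, h] using hgp
    have hα : α (σ.symm p) ≠ 0 := by simpa [hA] using h
    have hle := h₁ _ hp hα
    rw [← hp'] at hα hle ⊢
    exact ⟨hα, hle⟩
  · refine ⟨?_, h₂ _ _ hp (by simpa [hA] using h)⟩
    have hpA : p ∈ A := by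
      rw [hgp]
      simp only [g, h, dite_false]
      exact hfA _
    simpa [hA] using hpA

/-- A sparse monomial of `J` with the same support degree as `lam k` and smaller weight lies in the
ideal generated by the orbits preceding `k`. -/
lemma sparseMon_mem_span_prev {K : Type*} [Field K] {s b : ℕ}
    {J : Ideal (MvPolynomial (Fin s × Fin b) K)}
    {t : ℕ} {lam : Fin t → Fin s → ℕ}
    (hord : ∀ i j : Fin t, i < j → partLT (lam i) (lam j))
    (hall : ∀ ν : Fin s → ℕ, IsMinSparseGen K s b J ν → ∃ i, partOf ν = lam i)
    {k : Fin t} {μ : Fin s → ℕ} (hb : ∀ i, μ i ≤ b) (hμ : sparseMon K s b μ ∈ J)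
    (hdeg : suppdeg μ = suppdeg (lam k)) (hwt : wt μ < wt (lam k)) :
    sparseMon K s b μ ∈ Ideal.span {g | ∃ (i : Fin t) (σ : Equiv.Perm (Fin s)), i < k ∧
        g = permMap K s b σ (sparseMon K s b (lam i))} := by
  obtain ⟨ρ, hρ, hle⟩ := exists_isMinSparseGen_of_mem hb hμ
  obtain ⟨i, hi⟩ := hall ρ hρ
  refine Ideal.mem_of_dvd _ (sparseMon_dvd_of_forall K hle)
    (Ideal.subset_span ⟨i, Tuple.sort ρ, ?_, ?_⟩)
  · have hd : suppdeg (lam i) = suppdeg ρ := by rw [← hi]; exact suppdeg_comp_perm _ _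
    have hw : wt (lam i) = wt ρ := by rw [← hi]; exact wt_comp_perm _ _
    have hlt : suppdeg ρ < suppdeg μ ∨ ρ = μ := by
      by_cases h : ∃ j, ρ j = 0 ∧ μ j ≠ 0
      · obtain ⟨j, hj, hj'⟩ := h
        exact Or.inl (suppdeg_lt_of_forall (fun l hl => by rw [hle l hl]; exact hl) hj hj')
      · push Not at h
        right
        ext j
        by_cases hj : ρ j = 0
        · rw [hj, h j hj]
        · exact (hle j hj).symm
    have hnot : ¬ partLT (lam k) (lam i) := by
      rcases hlt with h | rfl
      · rintro (h' | ⟨h', -⟩ | ⟨h', -⟩) <;> omega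
      · rintro (h' | ⟨-, h'⟩ | ⟨-, h', -⟩) <;> omega
    rcases lt_trichotomy i k with h | rfl | h
    · exact h
    · rcases hlt with h | rfl <;> omega
    · exact absurd (hord _ _ h) hnot
  · rw [permMap_sparseMon, ← hi]
    congr 1
    ext j
    simp [partOf]

lemma sparseMon_mul_X_eq (K : Type*) [Field K] {s b : ℕ} (μ : Fin s → ℕ) (p : Fin s)
    (j : Fin b) :
    sparseMon K s b μ * X (p, j) = monomial (sparseExp b μ + Finsupp.single (p, j) 1) 1 := by
  rw [sparseMon_eq_monomial, X, monomial_mul, mul_one]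

lemma sparseMon_mul_X_mem {K : Type*} [Field K] {s b : ℕ} {μ : Fin s → ℕ}
    {I : Ideal (MvPolynomial (Fin s × Fin b) K)} {p q : Fin s} (j : Fin b)
    (hpq : p = q ∨ μ p = 0)
    (h : sparseMon K s b (Function.update μ q (j + 1) ∘ Equiv.swap p q) ∈ I) :
    sparseMon K s b μ * X (p, j) ∈ I := by
  rw [sparseMon_eq_monomial] at h
  rw [sparseMon_mul_X_eq]
  refine monomial_mem_of_le h (fun x => ?_) 1
  obtain ⟨i, l⟩ := x
  simp only [sparseExp, exps, Finsupp.equivFunOnFinite_symm_apply_apply, Finsupp.add_apply]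
  by_cases hip : i = p
  · subst hip
    by_cases hjl : j = l
    · subst hjl; simp
    · have : (j : ℕ) ≠ l := fun h => hjl (Fin.ext h)
      simp [this]
  · by_cases hiq : i = q
    · subst hiq
      simp [Ne.symm hip, hpq.resolve_left (Ne.symm hip)]
    · simp [Equiv.swap_apply_of_ne_of_ne hip hiq, hiq]

lemma permMap_sparseMon_mul_X (K : Type*) [Field K] {s b : ℕ} (σ : Equiv.Perm (Fin s))
    (μ : Fin s → ℕ) (p : Fin s) (j : Fin b) :
    permMap K s b σ (sparseMon K s b μ * X (p, j)) =
      sparseMon K s b (μ ∘ σ.symm) * X (σ p, j) := by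
  rw [map_mul, permMap_sparseMon]
  simp [permMap]

/-- If a monomial is divisible by `z^α` with `α` a minimal generator, and by `z^β` with `β` a minimal
generator whose partition precedes that of `α`, then it is divisible by one of the monomials
`z^α z_{p,j}` with `j < α p`, or with `α p = 0` and `j` smaller than some entry of `α`. -/
lemma exists_add_single_le {K : Type*} [Field K] {s b : ℕ}
    {J : Ideal (MvPolynomial (Fin s × Fin b) K)} (hJ : IsSSS K s b J) {α β l l' : Fin s → ℕ}
    (hα : IsMinSparseGen K s b J α) (hβ : IsMinSparseGen K s b J β)
    (hl : Monotone l) (hl' : Monotone l') {σ τ : Equiv.Perm (Fin s)}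
    (hαl : α = l ∘ σ) (hβl : β = l' ∘ τ) (hlt : partLT l' l) {m : Fin s × Fin b →₀ ℕ}
    (hαm : sparseExp b α ≤ m) (hβm : sparseExp b β ≤ m) :
    ∃ (p : Fin s) (j : Fin b), sparseExp b α + Finsupp.single (p, j) 1 ≤ m ∧
      ((0 < α p ∧ (j : ℕ) + 1 < α p) ∨ (α p = 0 ∧ ∃ q, (j : ℕ) + 1 < α q)) := by
  have hadd : ∀ (p : Fin s) (j : Fin b), α p ≠ j + 1 → β p = j + 1 →
      sparseExp b α + Finsupp.single (p, j) 1 ≤ m := by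
    intro p j hne heq x
    by_cases hx : x = (p, j)
    · subst hx
      have h := hβm (p, j)
      simp only [sparseExp, exps, Finsupp.equivFunOnFinite_symm_apply_apply, heq] at h
      simpa [sparseExp, exps, hne] using h
    · simpa [Finsupp.single_apply, Ne.symm hx] using hαm x
  by_contra! hcon
  have hfin : ∀ p, β p ≠ 0 → ∃ j : Fin b, β p = j + 1 := fun p hp =>
    ⟨⟨β p - 1, by have := hβ.1 p; omega⟩, by simp only; omega⟩
  have h₁ : ∀ p, β p ≠ 0 → α p ≠ 0 → α p ≤ β p := by
    intro p hp hp'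
    obtain ⟨j, hj⟩ := hfin p hp
    by_contra! h
    have := (hcon p j (hadd p j (by omega) hj)).1 (by omega)
    omega
  have h₂ : ∀ p q, β p ≠ 0 → α p = 0 → α q ≤ β p := by
    intro p q hp hp'
    obtain ⟨j, hj⟩ := hfin p hp
    have := (hcon p j (hadd p j (by omega) hj)).2 hp' q
    omega
  have hdα : suppdeg α = suppdeg l := hαl ▸ suppdeg_comp_perm _ _
  have hdβ : suppdeg β = suppdeg l' := hβl ▸ suppdeg_comp_perm _ _
  have hwα : wt α = wt l := hαl ▸ wt_comp_perm _ _
  have hwβ : wt β = wt l' := hβl ▸ wt_comp_perm _ _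
  obtain ⟨π, hπ⟩ := exists_perm_dominating
    (by rcases hlt with h | ⟨h, -⟩ | ⟨h, -⟩ <;> omega) h₁ h₂
  by_cases hq : ∃ q, α q ≠ 0 ∧ β (π q) = 0
  · obtain ⟨q, hαq, hβq⟩ := hq
    let γ : Fin s → ℕ := fun p => if β (π p) = 0 then 0 else α p
    have hγ : sparseMon K s b γ ∈ J := by
      refine hJ.2.2.1 _ (hβ.comp_perm hJ π) γ fun p => ?_
      by_cases hp : β (π p) = 0
      · simp [γ, hp]
      · simpa [γ, hp] using (hπ p hp).symm
    refine hα.2.2 q (Nat.pos_of_ne_zero hαq)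
      (Ideal.mem_of_dvd _ (sparseMon_dvd_of_forall K fun p hp => ?_) hγ)
    by_cases hp' : β (π p) = 0
    · simp [γ, hp'] at hp
    · have hpq : p ≠ q := fun h => hp' (h ▸ hβq)
      simp [γ, hp', hpq]
  · push Not at hq
    have hle : ∀ p, α p ≤ (β ∘ π) p := by
      intro p
      by_cases hp : α p = 0
      · simp [hp]
      · exact (hπ p (hq p hp)).2
    have hdle : suppdeg α ≤ suppdeg (β ∘ π) :=
      Finset.card_le_card fun p => by simpa using hq p
    rw [suppdeg_comp_perm] at hdle
    have hwle : wt α ≤ wt (β ∘ π) := Finset.sum_le_sum fun p _ => hle p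
    have hwπ : wt (β ∘ π) = wt β := wt_comp_perm _ _
    rcases hlt with h | ⟨-, h⟩ | ⟨-, h, i, hi, -⟩
    · omega
    · omega
    · have heq : α = β ∘ π := by
        have := (Finset.sum_eq_sum_iff_of_le fun p _ => hle p).1
          (show wt α = wt (β ∘ π) by omega)
        exact funext fun p => this p (Finset.mem_univ p)
      have : l' = l := by
        refine eq_of_monotone_of_comp_perm hl' hl (σ.symm.trans (π.trans τ)) ?_
        ext p
        have h := congrFun heq (σ.symm p)
        simp only [hαl, hβl, Function.comp_apply, Equiv.apply_symm_apply] at h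
        exact h.symm
      exact absurd hi (by rw [this]; exact lt_irrefl _)

/-- For a sparse symmetric shifted ideal `J` whose generator partitions are
`λ⁽¹⁾ ≺ ⋯ ≺ λ⁽ᵗ⁾`, the intersection `⟨σ(z^{λ⁽ᵏ⁾}) : σ⟩ ∩ J_{≤k-1}` equals `K₁ + K₂`. -/
theorem orbit_inter_prev {K : Type*} [Field K] (s b : ℕ) (hs : 0 < s)
    (J : Ideal (MvPolynomial (Fin s × Fin b) K)) (hJ : IsSSS K s b J)
    (t : ℕ) (lam : Fin t → Fin s → ℕ)
    (hpart : ∀ i, Monotone (lam i) ∧ ∀ j, lam i j ≤ b)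
    (hord : ∀ i j : Fin t, i < j → partLT (lam i) (lam j))
    (hall : ∀ ν : Fin s → ℕ, IsMinSparseGen K s b J ν → ∃ i, partOf ν = lam i)
    (hocc : ∀ i : Fin t, ∃ ν : Fin s → ℕ, IsMinSparseGen K s b J ν ∧ partOf ν = lam i)
    (k : Fin t) :
    Ideal.span {g | ∃ σ : Equiv.Perm (Fin s),
        g = permMap K s b σ (sparseMon K s b (lam k))} ⊓
      Ideal.span {g | ∃ (i : Fin t) (σ : Equiv.Perm (Fin s)), i < k ∧
        g = permMap K s b σ (sparseMon K s b (lam i))} =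
    Ideal.span {g | ∃ (σ : Equiv.Perm (Fin s)) (i : Fin s) (j : Fin b),
        0 < lam k i ∧ (j : ℕ) + 1 < lam k i ∧
        g = permMap K s b σ (sparseMon K s b (lam k) * X (i, j))} +
      Ideal.span {g | ∃ (σ : Equiv.Perm (Fin s)) (i : Fin s) (j : Fin b),
        lam k i = 0 ∧ (j : ℕ) + 1 < lam k ⟨s - 1, by omega⟩ ∧
        g = permMap K s b σ (sparseMon K s b (lam k) * X (i, j))} := by
  have hmin : ∀ (i : Fin t) (σ : Equiv.Perm (Fin s)), IsMinSparseGen K s b J (lam i ∘ σ) := by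
    intro i σ
    obtain ⟨ν, hν, hi⟩ := hocc i
    rw [← hi]
    exact (hν.comp_perm hJ (Tuple.sort ν)).comp_perm hJ σ
  rw [Submodule.add_eq_sup, ← Ideal.span_union]
  apply le_antisymm
  · rintro x ⟨hx₁, hx₂⟩
    rw [x.as_sum]
    refine Ideal.sum_mem _ fun m hm => ?_
    obtain ⟨e, hem, σ, he⟩ := exists_exponent_le_of_mem_span
      (by rintro g ⟨σ, rfl⟩; exact ⟨_, by rw [permMap_sparseMon, sparseMon_eq_monomial]⟩) hx₁ hm
    obtain ⟨e', hem', i, τ, hi, he'⟩ := exists_exponent_le_of_mem_span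
      (by rintro g ⟨i, σ, -, rfl⟩; exact ⟨_, by rw [permMap_sparseMon, sparseMon_eq_monomial]⟩)
      hx₂ hm
    rw [permMap_sparseMon, sparseMon_eq_monomial] at he he'
    obtain rfl := monomial_left_injective one_ne_zero he
    obtain rfl := monomial_left_injective one_ne_zero he'
    obtain ⟨p, j, hle, hp⟩ := exists_add_single_le hJ (hmin k _) (hmin i _) (hpart k).1
      (hpart i).1 rfl rfl (hord i k hi) hem hem'
    refine monomial_mem_of_le (Ideal.subset_span ?_) hle _
    rw [← sparseMon_mul_X_eq]
    have hgen : sparseMon K s b (lam k ∘ σ.symm) * X (p, j) =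
        permMap K s b σ (sparseMon K s b (lam k) * X (σ.symm p, j)) := by
      rw [permMap_sparseMon_mul_X, Equiv.apply_symm_apply]
    rcases hp with ⟨hp, hj⟩ | ⟨hp, q, hj⟩
    · exact Or.inl ⟨σ, σ.symm p, j, hp, hj, hgen⟩
    · refine Or.inr ⟨σ, σ.symm p, j, hp, hj.trans_le ((hpart k).1 ?_), hgen⟩
      exact Fin.le_def.2 (by simp only; omega)
  · have key : ∀ (σ : Equiv.Perm (Fin s)) (p q : Fin s) (j : Fin b),
        (p = q ∨ lam k p = 0) → (j : ℕ) + 1 < lam k q →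
        permMap K s b σ (sparseMon K s b (lam k) * X (p, j)) ∈
          Ideal.span {g | ∃ σ : Equiv.Perm (Fin s),
            g = permMap K s b σ (sparseMon K s b (lam k))} ⊓
          Ideal.span {g | ∃ (i : Fin t) (σ : Equiv.Perm (Fin s)), i < k ∧
            g = permMap K s b σ (sparseMon K s b (lam i))} := by
      intro σ p q j hpq hj
      refine ⟨?_, ?_⟩
      · rw [map_mul]
        exact Ideal.mul_mem_right _ _ (Ideal.subset_span ⟨σ, rfl⟩)
      · rw [permMap_sparseMon_mul_X]
        set α := lam k ∘ σ.symm with hα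
        have hαq : (j : ℕ) + 1 < α (σ q) := by simpa [hα] using hj
        have hne : ∀ i, Function.update α (σ q) (j + 1) i = 0 ↔ α i = 0 := by
          intro i
          by_cases hi : i = σ q
          · subst hi; simp only [Function.update_self]; omega
          · simp [hi]
        have hle : ∀ i, Function.update α (σ q) (j + 1) i ≤ α i := by
          intro i
          by_cases hi : i = σ q
          · subst hi; simpa using hαq.le
          · simp [hi]
        refine sparseMon_mul_X_mem (q := σ q) j (by simpa [hα] using hpq) ?_
        refine sparseMon_mem_span_prev hord hall
          (fun i => (hle _).trans ((hmin k σ.symm).1 _))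
          (hJ.sparseMon_comp_mem
            (hJ.2.2.1 α (hmin k σ.symm) _ fun i => ⟨hle i, hne i⟩) _) ?_ ?_
        · rw [suppdeg_comp_perm, ← suppdeg_comp_perm (lam k) σ.symm]
          exact congrArg Finset.card (Finset.filter_congr fun i _ => not_congr (hne i))
        · rw [wt_comp_perm, ← wt_comp_perm (lam k) σ.symm]
          exact Finset.sum_lt_sum (fun i _ => hle i)
            ⟨σ q, Finset.mem_univ _, by rwa [Function.update_self]⟩
    rw [Ideal.span_le]
    rintro g (⟨σ, i, j, -, hj, rfl⟩ | ⟨σ, i, j, hi, hj, rfl⟩)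
    · exact key σ i i j (Or.inl rfl) hj
    · exact key σ i _ j (Or.inr hi) hj
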